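/- Let q, a, b ∈ k with b ≠ 0 and q^j ≠ 1 for all 1 ≤ j ≤ m, and let α : ℕ × ℕ → k satisfy (q^{l₁+1} − 1)·b·α(l₁+1, l₂) = a·(q^{l₂+1} − 1)·α(l₁, l₂+1) for all l₁, l₂ ≥ 0 with l₁ + l₂ + 1 = m. Then for all l₁, l₂ ≥ 0 with l₁ + l₂ = m one has b^{l₁}·α(l₁, l₂) = binom(m,l₁)_q · a^{l₁} · α(0, m). -/

import Mathlib

/-- The Gaussian (quantum) binomial coefficient `binom(n,k)_q`, defined by
`binom(n,0)_q = 1`, `binom(n,k)_q = 0` for `k > n`, and the q-Pascal rule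
`binom(n+1,k)_q = binom(n,k)_q + q^(n+1-k) · binom(n,k-1)_q` for `1 ≤ k ≤ n+1`. -/
def qBinom {R : Type*} [CommRing R] (q : R) : ℕ → ℕ → R
  | _, 0 => 1
  | 0, _ + 1 => 0
  | n + 1, k + 1 => qBinom q n (k + 1) + q ^ (n - k) * qBinom q n k

theorem qBinom_zero_of_lt {R : Type*} [CommRing R] (q : R) :
    ∀ n k : ℕ, n < k → qBinom q n k = 0 := by
  intro n
  induction n with
  | zero =>
    intro k hk
    obtain ⟨j, rfl⟩ : ∃ j, k = j + 1 := ⟨k - 1, by omega⟩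
    simp [qBinom]
  | succ n ih =>
    intro k hk
    obtain ⟨j, rfl⟩ : ∃ j, k = j + 1 := ⟨k - 1, by omega⟩
    simp [qBinom, ih (j + 1) (by omega), ih j (by omega)]

theorem qBinom_right_zero {R : Type*} [CommRing R] (q : R) (n : ℕ) : qBinom q n 0 = 1 := by
  cases n <;> simp [qBinom]

theorem qBinom_step {R : Type*} [CommRing R] (q : R) :
    ∀ n k d : ℕ, k + d = n →
      (q ^ (k + 1) - 1) * qBinom q n (k + 1) = (q ^ d - 1) * qBinom q n k := by
  intro n
  induction n with
  | zero =>
    intro k d h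
    obtain ⟨rfl, rfl⟩ : k = 0 ∧ d = 0 := by omega
    simp [qBinom]
  | succ n ih =>
    intro k d h
    rcases d with _ | e
    · rw [qBinom_zero_of_lt q _ _ (by omega)]; simp
    · have h1 := ih k e (by omega)
      have hs : n - k = e := by omega
      rcases k with _ | j
      · simp only [qBinom, hs, qBinom_right_zero] at *
        linear_combination h1
      · have h2 := ih j (e + 1) (by omega)
        have hs' : n - j = e + 1 := by omega
        simp only [qBinom, hs, hs'] at *
        linear_combination h1 + q ^ (e + 1) * h2

/-- Let `q, a, b ∈ k` with `b ≠ 0` and `q^j ≠ 1` for all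
`1 ≤ j ≤ m`, and let `α : ℕ × ℕ → k` satisfy
`(q^(l₁+1) − 1)·b·α(l₁+1, l₂) = a·(q^(l₂+1) − 1)·α(l₁, l₂+1)` whenever
`l₁ + l₂ + 1 = m`.  Then for all `l₁ + l₂ = m` one has
`b^l₁·α(l₁, l₂) = binom(m,l₁)_q · a^l₁ · α(0, m)`. -/
theorem coideal_coefficient_recursion
    {k : Type*} [Field k] (m : ℕ) (q a b : k) (hb : b ≠ 0)
    (hq : ∀ j : ℕ, 1 ≤ j → j ≤ m → q ^ j ≠ 1)
    (α : ℕ → ℕ → k)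
    (hrec : ∀ l₁ l₂ : ℕ, l₁ + l₂ + 1 = m →
      (q ^ (l₁ + 1) - 1) * b * α (l₁ + 1) l₂ = a * (q ^ (l₂ + 1) - 1) * α l₁ (l₂ + 1)) :
    ∀ l₁ l₂ : ℕ, l₁ + l₂ = m →
      b ^ l₁ * α l₁ l₂ = qBinom q m l₁ * a ^ l₁ * α 0 m := by
  intro l₁
  induction l₁ with
  | zero =>
    intro l₂ h
    obtain rfl : l₂ = m := by omega
    simp [qBinom_right_zero]
  | succ l ih =>
    intro l₂ h
    have h1 := hrec l l₂ (by omega)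
    have h2 := ih (l₂ + 1) (by omega)
    have h3 := qBinom_step q m l (l₂ + 1) (by omega)
    have h4 : q ^ (l + 1) - 1 ≠ 0 := sub_ne_zero.mpr (hq (l + 1) (by omega) (by omega))
    apply mul_left_cancel₀ h4
    linear_combination b ^ l * h1 + a * (q ^ (l₂ + 1) - 1) * h2 - a ^ (l + 1) * α 0 m * h3
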